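/- (Proposition 1 of the paper: the robust value dominates the reward-adjusted value.) Assume Assumption 1 holds, define the adjusted reward r̂ x a = r x a − (γ·Rmax/(1−γ)) · e x a, and let U(P̂, e) be the set of all transition kernels P with ∑_{x'} |P x a x' − P̂ x a x'| ≤ e x a for all x, a. Then for every policy π and every kernel P ∈ U(P̂, e), ρ(π, P, r) ≥ ρ(π, P̂, r̂); hence the robust return of π over U(P̂, e) is at least its return in the reward-adjusted simulated MDP. -/

import Mathlib

open Matrix

/-- The row-stochastic matrix induced by a policy `π` from a transition kernel `P`. -/
noncomputable def polMat {X A : Type*} [Fintype A]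
    (P : X → A → X → ℝ) (π : X → A → ℝ) : Matrix X X ℝ :=
  Matrix.of fun x x' => ∑ a, π x a * P x a x'

/-- The reward vector induced by a policy `π` from a reward function `r`. -/
noncomputable def polRew {X A : Type*} [Fintype A]
    (r : X → A → ℝ) (π : X → A → ℝ) : X → ℝ :=
  fun x => ∑ a, π x a * r x a

/-- The value function `V^π_{P,r} = (1 - γ • P_π)⁻¹ *ᵥ r_π`. -/
noncomputable def valueFn {X A : Type*} [Fintype X] [DecidableEq X] [Fintype A]
    (γ : ℝ) (P : X → A → X → ℝ) (r : X → A → ℝ) (π : X → A → ℝ) : X → ℝ :=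
  ((1 : Matrix X X ℝ) - γ • polMat P π)⁻¹ *ᵥ polRew r π

/-- The return `ρ(π, P, r) = ∑ x, p0 x * V^π_{P,r} x`. -/
noncomputable def ret {X A : Type*} [Fintype X] [DecidableEq X] [Fintype A]
    (p0 : X → ℝ) (γ : ℝ) (P : X → A → X → ℝ) (r : X → A → ℝ) (π : X → A → ℝ) : ℝ :=
  ∑ x, p0 x * valueFn γ P r π x

/-- A transition kernel: nonnegative entries, each row summing to one. -/
def IsKernel {X A : Type*} [Fintype X] (P : X → A → X → ℝ) : Prop :=
  (∀ x a x', 0 ≤ P x a x') ∧ ∀ x a, ∑ x', P x a x' = 1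

/-- A randomized stationary policy. -/
def IsPolicy {X A : Type*} [Fintype A] (π : X → A → ℝ) : Prop :=
  (∀ x a, 0 ≤ π x a) ∧ ∀ x, ∑ a, π x a = 1

/-- The error function `e_π x = ∑ a, π x a * e x a` induced by a policy. -/
noncomputable def polErr {X A : Type*} [Fintype A]
    (e : X → A → ℝ) (π : X → A → ℝ) : X → ℝ :=
  fun x => ∑ a, π x a * e x a

/-- The normalized state occupancy frequency
`u^π_P x = (1 - γ) * ∑ y, p0 y * ((1 - γ • P_π)⁻¹) y x`. -/
noncomputable def occupancy {X A : Type*} [Fintype X] [DecidableEq X] [Fintype A]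
    (p0 : X → ℝ) (γ : ℝ) (P : X → A → X → ℝ) (π : X → A → ℝ) : X → ℝ :=
  fun x => (1 - γ) * ∑ y, p0 y * ((1 : Matrix X X ℝ) - γ • polMat P π)⁻¹ y x

/-- Minimum principle for discounted stochastic matrices. -/
lemma aux_min {X : Type*} [Fintype X] [Nonempty X] (γ : ℝ) (hγ0 : 0 ≤ γ) (hγ1 : γ < 1)
    (M : Matrix X X ℝ) (hM : ∀ x y, 0 ≤ M x y) (hM1 : ∀ x, ∑ y, M x y = 1)
    (D : X → ℝ) (hD : ∀ x, γ * ∑ y, M x y * D y ≤ D x) (x : X) : 0 ≤ D x := by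
  obtain ⟨m, hm⟩ := Finite.exists_min D
  have h1 : D m ≤ ∑ y, M m y * D y := by
    calc D m = ∑ y, M m y * D m := by rw [← Finset.sum_mul, hM1, one_mul]
      _ ≤ _ := Finset.sum_le_sum fun y _ => mul_le_mul_of_nonneg_left (hm y) (hM m y)
  have h2 := hD m
  have h3 := mul_le_mul_of_nonneg_left h1 hγ0
  have h4 : 0 ≤ (1 - γ) * D m := by linarith
  have h5 : 0 ≤ D m := nonneg_of_mul_nonneg_right h4 (by linarith)
  exact h5.trans (hm x)

lemma aux_unit {X : Type*} [Fintype X] [Nonempty X] [DecidableEq X]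
    (γ : ℝ) (hγ0 : 0 ≤ γ) (hγ1 : γ < 1)
    (M : Matrix X X ℝ) (hM : ∀ x y, 0 ≤ M x y) (hM1 : ∀ x, ∑ y, M x y = 1) :
    IsUnit ((1 : Matrix X X ℝ) - γ • M) := by
  rw [← Matrix.mulVec_injective_iff_isUnit]
  intro v w hvw
  have key : ∀ x, (v x - w x) = γ * ∑ y, M x y * (v y - w y) := by
    intro x
    have := congrFun hvw x
    simp only [Matrix.sub_mulVec, Matrix.one_mulVec, Matrix.smul_mulVec, Pi.sub_apply,
      Pi.smul_apply, smul_eq_mul] at this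
    simp only [Matrix.mulVec, dotProduct] at this
    simp only [mul_sub, Finset.sum_sub_distrib]
    linarith
  ext x
  have a := aux_min γ hγ0 hγ1 M hM hM1 (fun x => v x - w x) (fun x => (key x).ge) x
  have b := aux_min γ hγ0 hγ1 M hM hM1 (fun x => -(v x - w x)) (fun x => by
    simp only [mul_neg, Finset.sum_neg_distrib]
    linarith [key x]) x
  linarith

lemma polMat_nonneg {X A : Type*} [Fintype X] [Fintype A]
    (P : X → A → X → ℝ) (π : X → A → ℝ) (hP : IsKernel P) (hπ : IsPolicy π) (x y : X) :
    0 ≤ polMat P π x y :=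
  Finset.sum_nonneg fun a _ => mul_nonneg (hπ.1 x a) (hP.1 x a y)

lemma polMat_apply_sum {X A : Type*} [Fintype X] [Fintype A]
    (P : X → A → X → ℝ) (π : X → A → ℝ) (v : X → ℝ) (x : X) :
    ∑ y, polMat P π x y * v y = ∑ a, π x a * ∑ y, P x a y * v y := by
  simp only [polMat, Matrix.of_apply, Finset.sum_mul, Finset.mul_sum]
  rw [Finset.sum_comm]
  simp only [mul_assoc]

lemma polMat_sum {X A : Type*} [Fintype X] [Fintype A]
    (P : X → A → X → ℝ) (π : X → A → ℝ) (hP : IsKernel P) (hπ : IsPolicy π) (x : X) :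
    ∑ y, polMat P π x y = 1 := by
  have := polMat_apply_sum P π (fun _ => 1) x
  simp only [mul_one, hP.2, hπ.2] at this
  exact this

/-- Bellman equation. -/
lemma valueFn_eq {X A : Type*} [Fintype X] [Nonempty X] [DecidableEq X] [Fintype A]
    (γ : ℝ) (hγ0 : 0 ≤ γ) (hγ1 : γ < 1) (P : X → A → X → ℝ) (r : X → A → ℝ) (π : X → A → ℝ)
    (hP : IsKernel P) (hπ : IsPolicy π) (x : X) :
    valueFn γ P r π x = polRew r π x + γ * ∑ y, polMat P π x y * valueFn γ P r π y := by
  have hu := aux_unit γ hγ0 hγ1 _ (polMat_nonneg P π hP hπ) (polMat_sum P π hP hπ)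
  have h : ((1 : Matrix X X ℝ) - γ • polMat P π) *ᵥ valueFn γ P r π = polRew r π := by
    rw [valueFn, Matrix.mulVec_mulVec, Matrix.mul_nonsing_inv _
      ((Matrix.isUnit_iff_isUnit_det _).1 hu), Matrix.one_mulVec]
  have := congrFun h x
  rw [Matrix.sub_mulVec, Matrix.one_mulVec, Matrix.smul_mulVec] at this
  simp only [Pi.sub_apply, Pi.smul_apply, smul_eq_mul] at this
  simp only [Matrix.mulVec, dotProduct] at this
  linarith

lemma polRew_abs {X A : Type*} [Fintype A] (r : X → A → ℝ) (π : X → A → ℝ)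
    (hπ : IsPolicy π) (R : ℝ) (hr : ∀ x a, |r x a| ≤ R) (x : X) : |polRew r π x| ≤ R := by
  calc |polRew r π x| ≤ ∑ a, |π x a * r x a| := Finset.abs_sum_le_sum_abs _ _
    _ ≤ ∑ a, π x a * R := Finset.sum_le_sum fun a _ => by
        rw [abs_mul, abs_of_nonneg (hπ.1 x a)]
        exact mul_le_mul_of_nonneg_left (hr x a) (hπ.1 x a)
    _ = R := by rw [← Finset.sum_mul, hπ.2, one_mul]

lemma valueFn_abs {X A : Type*} [Fintype X] [Nonempty X] [DecidableEq X] [Fintype A]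
    (γ : ℝ) (hγ0 : 0 ≤ γ) (hγ1 : γ < 1) (P : X → A → X → ℝ) (r : X → A → ℝ) (π : X → A → ℝ)
    (hP : IsKernel P) (hπ : IsPolicy π) (R : ℝ) (hr : ∀ x a, |r x a| ≤ R) (x : X) :
    |valueFn γ P r π x| ≤ R / (1 - γ) := by
  have hB : R / (1 - γ) = R + γ * (R / (1 - γ)) := by
    have : (1 - γ) ≠ 0 := by linarith
    field_simp
    ring
  have h1 := polMat_sum P π hP hπ
  have hq := fun x => abs_le.1 (polRew_abs r π hπ R hr x)
  have hv := valueFn_eq γ hγ0 hγ1 P r π hP hπ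
  generalize R / (1 - γ) = B at *
  rw [abs_le]
  have a := aux_min γ hγ0 hγ1 _ (polMat_nonneg P π hP hπ) h1
    (fun x => B - valueFn γ P r π x) (fun x => by
      simp only [mul_sub, Finset.sum_sub_distrib, ← Finset.sum_mul, h1]
      linarith [hv x, (hq x).2]) x
  have b := aux_min γ hγ0 hγ1 _ (polMat_nonneg P π hP hπ) h1
    (fun x => B + valueFn γ P r π x) (fun x => by
      simp only [mul_add, Finset.sum_add_distrib, ← Finset.sum_mul, h1]
      linarith [hv x, (hq x).1]) x
  constructor <;> linarith

/-- Proposition 1: for every policy `π` and kernel `P ∈ U(P̂, e)`,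
`ρ(π, P, r) ≥ ρ(π, P̂, r̂)`, where `r̂ x a = r x a − (γ Rmax/(1−γ)) e x a`. -/
theorem robust_value_dominates_reward_adjusted
    {X A : Type*} [Fintype X] [Nonempty X] [DecidableEq X] [Fintype A] [Nonempty A]
    (γ : ℝ) (hγ0 : 0 ≤ γ) (hγ1 : γ < 1)
    (Rmax : ℝ) (hR : 0 ≤ Rmax)
    (r : X → A → ℝ) (hr : ∀ x a, |r x a| ≤ Rmax)
    (p0 : X → ℝ) (hp0 : ∀ x, 0 ≤ p0 x) (hp1 : ∑ x, p0 x = 1)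
    (Pstar Phat : X → A → X → ℝ) (hPstar : IsKernel Pstar) (hPhat : IsKernel Phat)
    (e : X → A → ℝ)
    (hAsm : ∀ x a, ∑ x', |Pstar x a x' - Phat x a x'| ≤ e x a)
    (rhat : X → A → ℝ)
    (hrhat : ∀ x a, rhat x a = r x a - γ * Rmax / (1 - γ) * e x a)
    (π : X → A → ℝ) (hπ : IsPolicy π)
    (P : X → A → X → ℝ) (hP : IsKernel P)
    (hPU : ∀ x a, ∑ x', |P x a x' - Phat x a x'| ≤ e x a) :
    ret p0 γ P r π ≥ ret p0 γ Phat rhat π := by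
  have hV := valueFn_eq γ hγ0 hγ1 P r π hP hπ
  have hW := valueFn_eq γ hγ0 hγ1 Phat rhat π hPhat hπ
  have hb := valueFn_abs γ hγ0 hγ1 P r π hP hπ Rmax hr
  have hB0 : 0 ≤ Rmax / (1 - γ) := div_nonneg hR (by linarith)
  simp only [mul_div_assoc] at hrhat
  unfold ret
  generalize valueFn γ P r π = V at *
  generalize valueFn γ Phat rhat π = W at *
  generalize Rmax / (1 - γ) = B at *
  have hrew : ∀ x, polRew rhat π x = polRew r π x - γ * (B * ∑ a, π x a * e x a) := by
    intro x
    simp only [polRew, hrhat, mul_sub, Finset.sum_sub_distrib, Finset.mul_sum]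
    congr 1
    exact Finset.sum_congr rfl fun a _ => by ring
  have hdiff : ∀ x, ∑ y, polMat Phat π x y * V y - ∑ y, polMat P π x y * V y
      ≤ B * ∑ a, π x a * e x a := by
    intro x
    rw [polMat_apply_sum, polMat_apply_sum, ← Finset.sum_sub_distrib, Finset.mul_sum]
    refine Finset.sum_le_sum fun a _ => ?_
    have h : ∑ y, Phat x a y * V y - ∑ y, P x a y * V y ≤ B * e x a := by
      rw [← Finset.sum_sub_distrib]
      calc ∑ y, (Phat x a y * V y - P x a y * V y)
          ≤ ∑ y, B * |P x a y - Phat x a y| := Finset.sum_le_sum fun y _ => by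
            rw [← sub_mul, abs_sub_comm, mul_comm B]
            refine (le_abs_self _).trans ?_
            rw [abs_mul]
            exact mul_le_mul_of_nonneg_left (hb y) (abs_nonneg _)
        _ = B * ∑ y, |P x a y - Phat x a y| := by rw [Finset.mul_sum]
        _ ≤ _ := mul_le_mul_of_nonneg_left (hPU x a) hB0
    have := mul_le_mul_of_nonneg_left h (hπ.1 x a)
    linarith
  have hD := aux_min γ hγ0 hγ1 _ (polMat_nonneg Phat π hPhat hπ) (polMat_sum Phat π hPhat hπ)
    (fun x => V x - W x) (fun x => by
      simp only [mul_sub, Finset.sum_sub_distrib]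
      have := mul_le_mul_of_nonneg_left (hdiff x) hγ0
      have h2 := hrew x
      have h3 := hV x
      have h4 := hW x
      linarith)
  exact Finset.sum_le_sum fun x _ =>
    mul_le_mul_of_nonneg_left (sub_nonneg.1 (hD x)) (hp0 x)
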